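/- arXiv:2012.00338 — 2 statements merged into one kernel-verified Lean document; each statement's English description precedes it below -/
import Mathlib

section
/- Let L₂ ∈ ℝ^{m×m} and let P ∈ ℝ^{m×m} be a symmetric positive definite matrix satisfying the Lyapunov equation L₂ᵀP + PL₂ = −I, with minimal and maximal eigenvalues λ_min > 0 and λ_max > 0. Let k₂ ≥ 0, let w ∈ ℝ^m with w ≠ 0, and let n ∈ ℝ^m with ‖n‖ ≤ k₂‖w‖. Then (1/(2√(wᵀPw))) · (wᵀ(PL₂ + L₂ᵀP)w + 2wᵀPn) ≤ −(1/(2√(λ_max)) − k₂λ_max/√(λ_min)) · ‖w‖. -/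
open Set Filter Topology Matrix RealInnerProductSpace

/-- `Euc n` is the Euclidean space `ℝ^n`. -/
abbrev Euc (n : ℕ) : Type := EuclideanSpace ℝ (Fin n)

section EigenvalueBounds

variable {m : ℕ} {A : Matrix (Fin m) (Fin m) ℝ}

theorem Matrix.IsHermitian.toEuclideanLin_eigenvectorBasis (hA : A.IsHermitian) (i : Fin m) :
    toEuclideanLin A (hA.eigenvectorBasis i) = hA.eigenvalues i • hA.eigenvectorBasis i := by
  ext j
  simpa using congrFun (hA.mulVec_eigenvectorBasis i) j

theorem Matrix.IsHermitian.inner_eigenvectorBasis_toEuclideanLin (hA : A.IsHermitian)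
    (i : Fin m) (x : Euc m) :
    ⟪hA.eigenvectorBasis i, toEuclideanLin A x⟫ =
      hA.eigenvalues i * ⟪hA.eigenvectorBasis i, x⟫ := by
  rw [← isSymmetric_toEuclideanLin_iff.mpr hA, hA.toEuclideanLin_eigenvectorBasis,
    real_inner_smul_left]

theorem Matrix.IsHermitian.inner_toEuclideanLin_eq_sum (hA : A.IsHermitian) (x : Euc m) :
    ⟪x, toEuclideanLin A x⟫ = ∑ i, hA.eigenvalues i * ⟪hA.eigenvectorBasis i, x⟫ ^ 2 := by
  rw [← hA.eigenvectorBasis.sum_inner_mul_inner]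
  refine Finset.sum_congr rfl fun i _ => ?_
  rw [hA.inner_eigenvectorBasis_toEuclideanLin, real_inner_comm]
  ring

theorem Matrix.IsHermitian.mul_norm_sq_le_inner_toEuclideanLin (hA : A.IsHermitian) {a : ℝ}
    (ha : a ∈ lowerBounds (spectrum ℝ A)) (x : Euc m) :
    a * ‖x‖ ^ 2 ≤ ⟪x, toEuclideanLin A x⟫ := by
  rw [hA.inner_toEuclideanLin_eq_sum, ← hA.eigenvectorBasis.sum_sq_inner_right x,
    Finset.mul_sum]
  gcongr with i
  exact ha (hA.eigenvalues_mem_spectrum_real i)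

theorem Matrix.IsHermitian.inner_toEuclideanLin_le_mul_norm_sq (hA : A.IsHermitian) {b : ℝ}
    (hb : b ∈ upperBounds (spectrum ℝ A)) (x : Euc m) :
    ⟪x, toEuclideanLin A x⟫ ≤ b * ‖x‖ ^ 2 := by
  rw [hA.inner_toEuclideanLin_eq_sum, ← hA.eigenvectorBasis.sum_sq_inner_right x,
    Finset.mul_sum]
  gcongr with i
  exact hb (hA.eigenvalues_mem_spectrum_real i)

theorem Matrix.PosSemidef.norm_toEuclideanLin_le (hA : A.PosSemidef) {b : ℝ} (hb₀ : 0 ≤ b)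
    (hb : b ∈ upperBounds (spectrum ℝ A)) (x : Euc m) :
    ‖toEuclideanLin A x‖ ≤ b * ‖x‖ := by
  refine (sq_le_sq₀ (norm_nonneg _) (by positivity)).mp ?_
  rw [mul_pow, ← hA.1.eigenvectorBasis.sum_sq_inner_right x,
    ← hA.1.eigenvectorBasis.sum_sq_inner_right (toEuclideanLin A x), Finset.mul_sum]
  refine Finset.sum_le_sum fun i _ => ?_
  rw [hA.1.inner_eigenvectorBasis_toEuclideanLin, mul_pow]
  gcongr
  · exact hA.eigenvalues_nonneg i
  · exact hb (hA.1.eigenvalues_mem_spectrum_real i)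

end EigenvalueBounds

/-- bound on the derivative of `√(wᵀPw)` along the transversal dynamics.
If `P` is symmetric positive definite with `L₂ᵀP + PL₂ = −I`, `λ_min` and `λ_max` are
its minimal and maximal eigenvalues, `w ≠ 0` and `‖n‖ ≤ k₂ ‖w‖`, then
`(1/(2√(wᵀPw))) (wᵀ(PL₂ + L₂ᵀP)w + 2 wᵀPn)
   ≤ −(1/(2√λ_max) − k₂ λ_max/√λ_min) ‖w‖`.
The quadratic forms `wᵀMw` are written as real inner products `⟪w, M w⟫`. -/
theorem lyapunov_transversal_bound {m : ℕ}
    (L₂ P : Matrix (Fin m) (Fin m) ℝ)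
    (hP : P.PosDef)
    (hLyap : L₂ᵀ * P + P * L₂ = -1)
    (lmin lmax : ℝ) (hlmin_pos : 0 < lmin) (hlmax_pos : 0 < lmax)
    (hmin : IsLeast (spectrum ℝ P) lmin) (hmax : IsGreatest (spectrum ℝ P) lmax)
    (k₂ : ℝ) (hk₂ : 0 ≤ k₂)
    (w n : Euc m) (hw : w ≠ 0) (hn : ‖n‖ ≤ k₂ * ‖w‖) :
    (1 / (2 * Real.sqrt ⟪w, Matrix.toEuclideanLin P w⟫)) *
        (⟪w, Matrix.toEuclideanLin (P * L₂ + L₂ᵀ * P) w⟫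
          + 2 * ⟪w, Matrix.toEuclideanLin P n⟫)
      ≤ -(1 / (2 * Real.sqrt lmax) - k₂ * lmax / Real.sqrt lmin) * ‖w‖ := by
  have hw' : 0 < ‖w‖ := norm_pos_iff.mpr hw
  have hlow := hP.1.mul_norm_sq_le_inner_toEuclideanLin hmin.2 w
  have hupp := hP.1.inner_toEuclideanLin_le_mul_norm_sq hmax.2 w
  have hquad : ⟪w, toEuclideanLin (P * L₂ + L₂ᵀ * P) w⟫ = -‖w‖ ^ 2 := by
    rw [add_comm, hLyap, map_neg, LinearMap.neg_apply, inner_neg_right]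
    simp [toLpLin_one]
  have hpert : ⟪w, toEuclideanLin P n⟫ ≤ k₂ * lmax * ‖w‖ ^ 2 := by
    calc ⟪w, toEuclideanLin P n⟫ ≤ ‖w‖ * ‖toEuclideanLin P n‖ := real_inner_le_norm _ _
      _ ≤ ‖w‖ * (lmax * (k₂ * ‖w‖)) := by
        gcongr
        exact (hP.posSemidef.norm_toEuclideanLin_le hlmax_pos.le hmax.2 n).trans (by gcongr)
      _ = k₂ * lmax * ‖w‖ ^ 2 := by ring
  rw [hquad]
  set s := √⟪w, toEuclideanLin P w⟫
  have hs_low : √lmin * ‖w‖ ≤ s := by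
    rw [← Real.sqrt_sq hw'.le, ← Real.sqrt_mul hlmin_pos.le]
    exact Real.sqrt_le_sqrt hlow
  have hs_upp : s ≤ √lmax * ‖w‖ := by
    rw [← Real.sqrt_sq hw'.le, ← Real.sqrt_mul hlmax_pos.le]
    exact Real.sqrt_le_sqrt hupp
  have hsmin : 0 < √lmin := Real.sqrt_pos.mpr hlmin_pos
  have hsmax : 0 < √lmax := Real.sqrt_pos.mpr hlmax_pos
  have hs : 0 < s := (mul_pos hsmin hw').trans_le hs_low
  have hdecay : ‖w‖ / (2 * √lmax) ≤ ‖w‖ ^ 2 / (2 * s) := by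
    rw [div_le_div_iff₀ (by positivity) (by positivity)]
    nlinarith
  have hgrowth : ⟪w, toEuclideanLin P n⟫ / s ≤ k₂ * lmax * ‖w‖ / √lmin := by
    calc ⟪w, toEuclideanLin P n⟫ / s ≤ k₂ * lmax * ‖w‖ ^ 2 / s := by gcongr
      _ ≤ k₂ * lmax * ‖w‖ ^ 2 / (√lmin * ‖w‖) := by gcongr
      _ = k₂ * lmax * ‖w‖ / √lmin := by field_simp
  calc 1 / (2 * s) * (-‖w‖ ^ 2 + 2 * ⟪w, toEuclideanLin P n⟫)
      = -(‖w‖ ^ 2 / (2 * s)) + ⟪w, toEuclideanLin P n⟫ / s := by field_simp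
    _ ≤ -(‖w‖ / (2 * √lmax)) + k₂ * lmax * ‖w‖ / √lmin := by gcongr
    _ = -(1 / (2 * √lmax) - k₂ * lmax / √lmin) * ‖w‖ := by ring
end

section
/- Let Ω ⊆ ℝ^d be an open set containing 0, and let H be a real Hilbert space whose elements are differentiable functions from Ω to ℝ^m, equipped with a kernel k: Ω × Ω → ℝ^{m×m} with the following reproducing properties: (i) for every x ∈ Ω and α ∈ ℝ^m the function k(·,x)α belongs to H and ⟨f, k(·,x)α⟩_H = αᵀf(x) for all f ∈ H; (ii) for every i ∈ {1,…,d} and β ∈ ℝ^m the function ∂_i^{(2)}k(·,0)β (the partial derivative of y ↦ k(·,y)β with respect to the i-th coordinate of the second argument, evaluated at 0) belongs to H and ⟨f, ∂_i^{(2)}k(·,0)β⟩_H = βᵀ∂_i f(0) for all f ∈ H. Let x₁,…,x_N ∈ Ω ∖ {0} be pairwise distinct points, y₁,…,y_N ∈ ℝ^m, and ω₁,…,ω_N ∈ ℝ^{m×m} symmetric positive definite; set x_{N+1} := 0 and define J(s) := ‖s‖²_H + Σ_{i=1}^N (s(x_i) − y_i)ᵀ ω_i (s(x_i) − y_i). Suppose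 α₁,…,α_{N+1} ∈ ℝ^m and β₁,…,β_d ∈ ℝ^m are such that the function ĥ := Σ_{i=1}^{N+1} k(·,x_i)α_i + Σ_{i=1}^d ∂_i^{(2)}k(·,0)β_i satisfies ĥ(x_i) = y_i − ω_i^{−1}α_i for i = 1,…,N, ĥ(0) = 0, and Dĥ(0) = 0. Then ĥ is the unique minimizer of J over the set {s ∈ H : s(0) = 0, Ds(0) = 0}. -/
open Set Filter Topology Matrix RealInnerProductSpace

/-- Expansion of a shifted quadratic form whose offset is `-ω⁻¹ a`. -/
lemma dotProduct_mulVec_add_neg_inv {n : Type*} [Fintype n] [DecidableEq n]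
    {ω : Matrix n n ℝ} (hs : ω.IsSymm) (hd : ω.PosDef) (t a : n → ℝ) :
    (t + -(ω⁻¹ *ᵥ a)) ⬝ᵥ ω *ᵥ (t + -(ω⁻¹ *ᵥ a)) =
      t ⬝ᵥ ω *ᵥ t - 2 * (a ⬝ᵥ t) + -(ω⁻¹ *ᵥ a) ⬝ᵥ ω *ᵥ -(ω⁻¹ *ᵥ a) := by
  have hu : IsUnit ω.det := (Matrix.isUnit_iff_isUnit_det ω).1 hd.isUnit
  have hr : ω *ᵥ (ω⁻¹ *ᵥ a) = a := by
    rw [Matrix.mulVec_mulVec, Matrix.mul_nonsing_inv ω hu, Matrix.one_mulVec]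
  have hc : (ω⁻¹ *ᵥ a) ⬝ᵥ ω *ᵥ t = a ⬝ᵥ t := by
    rw [Matrix.dotProduct_mulVec, ← Matrix.mulVec_transpose, hs.eq, hr]
  simp only [Matrix.mulVec_add, Matrix.mulVec_neg, add_dotProduct, dotProduct_add,
    neg_dotProduct, dotProduct_neg, hc, hr, dotProduct_comm t a]
  ring

/-- representer theorem for the kernel-based approximation of the center
manifold. `H` is a real Hilbert space of differentiable functions `Ω → ℝ^m` (realized
through an injective linear map `ι` into functions), with a matrix-valued reproducing
kernel `k`: `K₀ x a` represents the function `k(·,x)a` and reproduces point evaluations,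
and `K₁ i b` represents `∂_i^{(2)}k(·,0)b` and reproduces the partial derivatives at `0`.
Given data `x₁,…,x_N ∈ Ω \ {0}` pairwise distinct, values `y_i`, positive definite
weights `ω_i`, and the functional
`J s = ‖s‖² + ∑ᵢ (s(xᵢ) − yᵢ)ᵀ ωᵢ (s(xᵢ) − yᵢ)`, if
`hA = ∑_{i=1}^{N+1} k(·, xᵢ) αᵢ + ∑_{i=1}^d ∂_i^{(2)}k(·,0) βᵢ` (with `x_{N+1} = 0`)
satisfies `hA(xᵢ) = yᵢ − ωᵢ⁻¹ αᵢ`, `hA(0) = 0` and `DhA(0) = 0`, then `hA` is the unique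
minimizer of `J` over `{s ∈ H : s(0) = 0, Ds(0) = 0}`. -/
theorem representer_theorem_center_manifold
    {d m N : ℕ}
    {H : Type*} [NormedAddCommGroup H] [InnerProductSpace ℝ H]
    (Ω : Set (Euc d)) (hΩ_open : IsOpen Ω) (h0Ω : (0 : Euc d) ∈ Ω)
    -- `H` is realized as a space of differentiable functions `Ω → ℝ^m`
    (ι : H →ₗ[ℝ] (Euc d → (Fin m → ℝ))) (hι_inj : Function.Injective ι)
    (hdiff : ∀ f : H, DifferentiableOn ℝ (ι f) Ω)
    -- the matrix-valued kernel and its reproducing properties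
    (k : Euc d → Euc d → Matrix (Fin m) (Fin m) ℝ)
    (K₀ : Euc d → (Fin m → ℝ) → H)
    (hK₀_repr : ∀ x ∈ Ω, ∀ a : Fin m → ℝ,
      ι (K₀ x a) = fun z => (k z x).mulVec a)
    (hK₀_prop : ∀ x ∈ Ω, ∀ (a : Fin m → ℝ) (f : H),
      ⟪f, K₀ x a⟫ = a ⬝ᵥ (ι f x))
    (K₁ : Fin d → (Fin m → ℝ) → H)
    (hK₁_repr : ∀ (i : Fin d) (b : Fin m → ℝ),
      ι (K₁ i b) = fun z =>
        fderiv ℝ (fun w : Euc d => (k z w).mulVec b) 0 (EuclideanSpace.single i 1))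
    (hK₁_prop : ∀ (i : Fin d) (b : Fin m → ℝ) (f : H),
      ⟪f, K₁ i b⟫ = b ⬝ᵥ (fderiv ℝ (ι f) 0 (EuclideanSpace.single i 1)))
    -- the data sites (pairwise distinct, nonzero), values and weights
    (x : Fin N → Euc d) (hx_mem : ∀ i, x i ∈ Ω) (hx_ne : ∀ i, x i ≠ 0)
    (hx_distinct : Function.Injective x)
    (y : Fin N → (Fin m → ℝ))
    (ω : Fin N → Matrix (Fin m) (Fin m) ℝ)
    (hω_symm : ∀ i, (ω i).IsSymm) (hω_pd : ∀ i, (ω i).PosDef)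
    -- the regularized least-squares functional
    (J : H → ℝ)
    (hJ : ∀ s, J s = ‖s‖ ^ 2
      + ∑ i, (ι s (x i) - y i) ⬝ᵥ (ω i).mulVec (ι s (x i) - y i))
    -- the candidate minimizer and the conditions on its coefficients
    (α : Fin (N + 1) → (Fin m → ℝ)) (β : Fin d → (Fin m → ℝ))
    (hA : H)
    (hA_def : hA = (∑ i : Fin (N + 1), K₀ ((Fin.snoc x 0 : Fin (N + 1) → Euc d) i) (α i))
      + ∑ i : Fin d, K₁ i (β i))
    (hA_data : ∀ i : Fin N, ι hA (x i) = y i - (ω i)⁻¹.mulVec (α i.castSucc))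
    (hA_0 : ι hA 0 = 0)
    (hA_D0 : fderiv ℝ (ι hA) 0 = 0) :
    ∀ s : H, ι s 0 = 0 → fderiv ℝ (ι s) 0 = 0 →
      J hA ≤ J s ∧ (J s = J hA → s = hA) := by
  intro s hs0 hsD
  obtain ⟨t, rfl⟩ : ∃ t, s = hA + t := ⟨s - hA, by abel⟩
  have ht0 : ι t 0 = 0 := by simpa [hA_0] using hs0
  have hdiff0 : ∀ f : H, DifferentiableAt ℝ (ι f) 0 := fun f =>
    (hdiff f).differentiableAt (hΩ_open.mem_nhds h0Ω)
  have htD : fderiv ℝ (ι t) 0 = 0 := by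
    rw [map_add, fderiv_add (hdiff0 hA) (hdiff0 t), hA_D0, zero_add] at hsD
    exact hsD
  have hinner : ⟪hA, t⟫ = ∑ i : Fin N, α i.castSucc ⬝ᵥ ι t (x i) := by
    rw [real_inner_comm, hA_def, inner_add_right, inner_sum, inner_sum, Fin.sum_univ_castSucc]
    simp [hK₀_prop _ (hx_mem _), hK₀_prop _ h0Ω, hK₁_prop, ht0, htD]
  have hsum : ∀ i, (ι (hA + t) (x i) - y i) ⬝ᵥ (ω i).mulVec (ι (hA + t) (x i) - y i) =
      ι t (x i) ⬝ᵥ (ω i).mulVec (ι t (x i)) - 2 * (α i.castSucc ⬝ᵥ ι t (x i)) +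
        (ι hA (x i) - y i) ⬝ᵥ (ω i).mulVec (ι hA (x i) - y i) := by
    intro i
    have hA_res : ι hA (x i) - y i = -((ω i)⁻¹ *ᵥ α i.castSucc) := by
      rw [hA_data]; abel
    have hs_res : ι (hA + t) (x i) - y i = ι t (x i) + -((ω i)⁻¹ *ᵥ α i.castSucc) := by
      rw [← hA_res, map_add, Pi.add_apply]; abel
    rw [hs_res, hA_res]
    exact dotProduct_mulVec_add_neg_inv (hω_symm i) (hω_pd i) _ _
  have hJt : J (hA + t) =
      J hA + ‖t‖ ^ 2 + ∑ i, ι t (x i) ⬝ᵥ (ω i).mulVec (ι t (x i)) := by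
    rw [hJ, hJ, Finset.sum_congr rfl fun i _ => hsum i, Finset.sum_add_distrib,
      Finset.sum_sub_distrib, ← Finset.mul_sum, norm_add_sq_real, hinner]
    ring
  have hnonneg : 0 ≤ ∑ i, ι t (x i) ⬝ᵥ (ω i).mulVec (ι t (x i)) :=
    Finset.sum_nonneg fun i _ => by
      simpa using (hω_pd i).posSemidef.dotProduct_mulVec_nonneg (ι t (x i))
  refine ⟨by nlinarith [sq_nonneg ‖t‖], fun h => ?_⟩
  have ht : ‖t‖ ^ 2 = 0 := le_antisymm (by linarith) (sq_nonneg _)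
  simpa using ht
end
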